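/- Let Λ be a quantum operation on d×d complex matrices with Kraus operators A_1,…,A_K (so Σ_k A_kᴴ A_k ≤ I), and let Λ⊗Λ be the quantum operation on d²×d² matrices with Kraus operators A_i ⊗ A_j (Kronecker products), 1 ≤ i,j ≤ K. Then there exist an isometry V from ℂ^{d²+1} to ℂ^{(d+1)²} (i.e., a (d+1)²×(d²+1) matrix with VᴴV = I) and finitely many (d+1)²×(d+1)² matrices K_1,…,K_M with Σ_m K_mᴴ K_m = I such that for every d²×d² matrix X, Σ_m K_m ((Γ_Λ ⊗ Γ_Λ)(X)) K_mᴴ = V · Γ_{Λ⊗Λ}(X) · Vᴴ, where Γ_Λ ⊗ Γ_Λ is the map on d²×d² matrices with Kraus operators given by the Kronecker products of the Kraus operators of Γ_Λ. That is, the generalized erasure channel Γ_{Λ⊗Λ} is (up to an isometric embedding of its output) a quantum channel composed with Γ_Λ^{⊗2}. -/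

import Mathlib

open Matrix ComplexOrder Kronecker

/-- The generalized erasure channel of a quantum operation Λ. -/
noncomputable def gec {n : Type*} [Fintype n] [DecidableEq n]
    (Λ : Matrix n n ℂ → Matrix n n ℂ) (X : Matrix n n ℂ) :
    Matrix (n ⊕ Fin 1) (n ⊕ Fin 1) ℂ :=
  Matrix.fromBlocks (Λ X) 0 0 (Matrix.of fun _ _ => X.trace - (Λ X).trace)

open scoped MatrixOrder in
/-- The Kraus operators of the generalized erasure channel Γ_Λ of the quantum operation with
Kraus operators A_1,…,A_K: the embedded operators ι∘A_k together with the operators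
e_{d+1}·(row j of √(I−E)). -/
noncomputable def krausGEC {d K : ℕ} (A : Fin K → Matrix (Fin d) (Fin d) ℂ)
    (hA : (1 - ∑ k, (A k)ᴴ * A k).PosSemidef) :
    Fin K ⊕ Fin d → Matrix (Fin d ⊕ Fin 1) (Fin d) ℂ
  | Sum.inl k => Matrix.of fun i j =>
      match i with
      | Sum.inl i' => A k i' j
      | Sum.inr _ => 0
  | Sum.inr r => Matrix.of fun i j =>
      match i with
      | Sum.inl _ => 0
      | Sum.inr _ => CFC.sqrt (1 - ∑ k, (A k)ᴴ * A k) r j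

open scoped MatrixOrder in
theorem sum_krausGEC_conjTranspose_mul {d K : ℕ} (A : Fin K → Matrix (Fin d) (Fin d) ℂ)
    (hA : (1 - ∑ k, (A k)ᴴ * A k).PosSemidef) :
    ∑ s, (krausGEC A hA s)ᴴ * krausGEC A hA s = 1 := by
  set S : Matrix (Fin d) (Fin d) ℂ := CFC.sqrt (1 - ∑ k, (A k)ᴴ * A k) with hS
  have hSS : Sᴴ * S = 1 - ∑ k, (A k)ᴴ * A k := by
    have h : Sᴴ = S := (CFC.sqrt_nonneg (1 - ∑ k, (A k)ᴴ * A k)).posSemidef.isHermitian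
    rw [h]
    exact CFC.sqrt_mul_sqrt_self _ hA.nonneg
  rw [Fintype.sum_sum_type]
  have h1 : ∀ k, (krausGEC A hA (Sum.inl k))ᴴ * krausGEC A hA (Sum.inl k) = (A k)ᴴ * A k := by
    intro k
    ext i j
    simp [krausGEC, Matrix.mul_apply]
  have h2 : ∑ r, (krausGEC A hA (Sum.inr r))ᴴ * krausGEC A hA (Sum.inr r) = Sᴴ * S := by
    ext i j
    simp [krausGEC, Matrix.mul_apply, Matrix.sum_apply, hS]
  simp [h1, h2, hSS]

theorem trace_sum_mul_mul_conjTranspose {ι m n : Type*} [Fintype ι] [Fintype m] [Fintype n]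
    [DecidableEq n] (B : ι → Matrix m n ℂ) (hB : ∑ s, (B s)ᴴ * B s = 1) (X : Matrix n n ℂ) :
    (∑ s, B s * X * (B s)ᴴ).trace = X.trace := by
  rw [Matrix.trace_sum]
  calc ∑ s, (B s * X * (B s)ᴴ).trace = ∑ s, ((B s)ᴴ * B s * X).trace := by
        refine Finset.sum_congr rfl fun s _ => ?_
        rw [Matrix.trace_mul_comm, Matrix.mul_assoc]
    _ = X.trace := by rw [← Matrix.trace_sum, ← Matrix.sum_mul, hB, Matrix.one_mul]

theorem sum_kronecker_conjTranspose_mul {ι m n : Type*} [Fintype ι] [Fintype m] [Fintype n]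
    [DecidableEq n] (B : ι → Matrix m n ℂ) (hB : ∑ s, (B s)ᴴ * B s = 1) :
    ∑ p : ι × ι, (B p.1 ⊗ₖ B p.2)ᴴ * (B p.1 ⊗ₖ B p.2) = 1 := by
  have h : ∀ p : ι × ι, (B p.1 ⊗ₖ B p.2)ᴴ * (B p.1 ⊗ₖ B p.2)
      = ((B p.1)ᴴ * B p.1) ⊗ₖ ((B p.2)ᴴ * B p.2) := fun p => by
    rw [Matrix.conjTranspose_kronecker, Matrix.mul_kronecker_mul]
  rw [Finset.sum_congr rfl fun p _ => h p, ← Matrix.one_kronecker_one, ← hB]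
  ext ⟨i, i'⟩ ⟨j, j'⟩
  simp only [Matrix.sum_apply, Matrix.kroneckerMap_apply, Fintype.sum_prod_type,
    Finset.sum_mul_sum]

/-- The good block, where neither output is erased, of the tensor square of the generalized
erasure channel. -/
theorem submatrix_sum_krausGEC_kronecker {d K : ℕ} (A : Fin K → Matrix (Fin d) (Fin d) ℂ)
    (hA : (1 - ∑ k, (A k)ᴴ * A k).PosSemidef) (X : Matrix (Fin d × Fin d) (Fin d × Fin d) ℂ) :
    (∑ s, ∑ t, (krausGEC A hA s ⊗ₖ krausGEC A hA t) * X *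
        (krausGEC A hA s ⊗ₖ krausGEC A hA t)ᴴ).submatrix
          (Prod.map Sum.inl Sum.inl) (Prod.map Sum.inl Sum.inl)
      = ∑ i, ∑ j, (A i ⊗ₖ A j) * X * (A i ⊗ₖ A j)ᴴ := by
  ext ⟨a, b⟩ ⟨a', b'⟩
  simp [Matrix.sum_apply, Matrix.mul_apply, krausGEC, Fintype.sum_sum_type]

/-- The isometry with columns the standard basis vectors indexed by an injective map. -/
def basisIsometry {m n : Type*} [DecidableEq m] (f : n → m) : Matrix m n ℂ :=
  (1 : Matrix m m ℂ).submatrix id f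

theorem basisIsometry_conjTranspose_mul_mul {m n n' : Type*} [Fintype m] [DecidableEq m]
    (f : n → m) (g : n' → m) (Y : Matrix m m ℂ) :
    (basisIsometry f)ᴴ * Y * basisIsometry g = Y.submatrix f g := by
  ext i j
  simp [basisIsometry, Matrix.mul_apply, Matrix.one_apply]

theorem basisIsometry_conjTranspose_mul_self {m n : Type*} [Fintype m] [DecidableEq m]
    [DecidableEq n] {f : n → m} (hf : Function.Injective f) :
    (basisIsometry f)ᴴ * basisIsometry f = 1 := by
  have h := basisIsometry_conjTranspose_mul_mul f f 1
  rwa [Matrix.mul_one, Matrix.submatrix_one _ hf] at h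

theorem basisIsometry_sumElim {m n n' : Type*} [DecidableEq m] (f : n → m) (g : n' → m) :
    basisIsometry (Sum.elim f g) = Matrix.fromCols (basisIsometry f) (basisIsometry g) := by
  ext i (j | j) <;> rfl

theorem basisIsometry_sumElim_mul_fromBlocks_mul {m n n' : Type*} [DecidableEq m]
    [Fintype n] [Fintype n'] (f : n → m) (g : n' → m) (L : Matrix n n ℂ) (C : Matrix n' n' ℂ) :
    basisIsometry (Sum.elim f g) * Matrix.fromBlocks L 0 0 C * (basisIsometry (Sum.elim f g))ᴴ
      = basisIsometry f * L * (basisIsometry f)ᴴ + basisIsometry g * C * (basisIsometry g)ᴴ := by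
  rw [basisIsometry_sumElim, Matrix.fromCols_mul_fromBlocks,
    Matrix.conjTranspose_fromCols_eq_fromRows_conjTranspose, Matrix.fromCols_mul_fromRows]
  simp

/-- Kraus operators of the channel which keeps the block of the first summand of `n ⊕ b ≃ m` and
maps every basis state of the second summand to the basis state `z`. -/
def collapseKraus {m n b : Type*} [Fintype n] [DecidableEq m] (e : n → m) (c : b → m) (z : m) :
    Option b → Matrix m m ℂ
  | none => basisIsometry e * (basisIsometry e)ᴴ
  | some q => basisIsometry (fun _ : Fin 1 => z) * (basisIsometry fun _ : Fin 1 => c q)ᴴ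

theorem sum_collapseKraus_conjTranspose_mul {m n b : Type*} [Fintype m] [DecidableEq m]
    [Fintype n] [DecidableEq n] [Fintype b] (e : n → m) (c : b → m) (z : m)
    (h : Function.Bijective (Sum.elim e c)) :
    ∑ o, (collapseKraus e c z o)ᴴ * collapseKraus e c z o = 1 := by
  have he : Function.Injective e := h.1.comp Sum.inl_injective
  have hz : (basisIsometry fun _ : Fin 1 => z)ᴴ * basisIsometry (fun _ : Fin 1 => z) = 1 :=
    basisIsometry_conjTranspose_mul_self (Function.injective_of_subsingleton _)
  have h0 : (collapseKraus e c z none)ᴴ * collapseKraus e c z none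
      = basisIsometry e * (basisIsometry e)ᴴ := by
    simp only [collapseKraus, Matrix.conjTranspose_mul, Matrix.conjTranspose_conjTranspose]
    rw [Matrix.mul_assoc, ← Matrix.mul_assoc _ (basisIsometry e),
      basisIsometry_conjTranspose_mul_self he, Matrix.one_mul]
  have h1 : ∀ q, (collapseKraus e c z (some q))ᴴ * collapseKraus e c z (some q)
      = basisIsometry (fun _ : Fin 1 => c q) * (basisIsometry fun _ : Fin 1 => c q)ᴴ := by
    intro q
    simp only [collapseKraus, Matrix.conjTranspose_mul, Matrix.conjTranspose_conjTranspose]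
    rw [Matrix.mul_assoc, ← Matrix.mul_assoc _ (basisIsometry fun _ : Fin 1 => z), hz,
      Matrix.one_mul]
  simp only [Fintype.sum_option, h0, h1]
  ext i j
  have key : ∑ x, (1 : Matrix m m ℂ) i (e x) * (1 : Matrix m m ℂ) (e x) j +
      ∑ x, (1 : Matrix m m ℂ) i (c x) * (1 : Matrix m m ℂ) (c x) j = (1 : Matrix m m ℂ) i j := by
    have := Fintype.sum_bijective _ h
      (fun x => (1 : Matrix m m ℂ) i (Sum.elim e c x) * (1 : Matrix m m ℂ) (Sum.elim e c x) j)
      (fun x => (1 : Matrix m m ℂ) i x * (1 : Matrix m m ℂ) x j) (fun _ => rfl)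
    rwa [Fintype.sum_sum_type, ← Matrix.mul_apply, Matrix.mul_one] at this
  rw [← key]
  simp only [basisIsometry, Matrix.conjTranspose_submatrix, Matrix.conjTranspose_one,
    Matrix.add_apply, Matrix.sum_apply, Matrix.mul_apply, Matrix.submatrix_apply,
    Finset.univ_unique, Finset.sum_const, Finset.card_singleton, one_smul]
  rfl

theorem sum_collapseKraus_mul_mul {m n b : Type*} [Fintype m] [DecidableEq m]
    [Fintype n] [Fintype b] (e : n → m) (c : b → m) (z : m)
    (h : Function.Bijective (Sum.elim e c)) (Y : Matrix m m ℂ) :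
    ∑ o, collapseKraus e c z o * Y * (collapseKraus e c z o)ᴴ
      = basisIsometry (Sum.elim e fun _ : Fin 1 => z) *
          Matrix.fromBlocks (Y.submatrix e e) 0 0
            (Matrix.of fun _ _ => Y.trace - (Y.submatrix e e).trace : Matrix (Fin 1) (Fin 1) ℂ) *
          (basisIsometry (Sum.elim e fun _ : Fin 1 => z))ᴴ := by
  have h1 : ∀ q, collapseKraus e c z (some q) * Y * (collapseKraus e c z (some q))ᴴ
      = basisIsometry (fun _ : Fin 1 => z) * Y.submatrix (fun _ : Fin 1 => c q) (fun _ : Fin 1 => c q) *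
          (basisIsometry fun _ : Fin 1 => z)ᴴ := by
    intro q
    rw [← basisIsometry_conjTranspose_mul_mul]
    simp only [collapseKraus, Matrix.conjTranspose_mul, Matrix.conjTranspose_conjTranspose,
      Matrix.mul_assoc]
  have htr : Y.trace = (Y.submatrix e e).trace + ∑ q, Y (c q) (c q) := by
    have := Fintype.sum_bijective _ h (fun x => Y (Sum.elim e c x) (Sum.elim e c x))
      (fun x => Y x x) (fun _ => rfl)
    rw [Fintype.sum_sum_type] at this
    exact this.symm
  have hsum : ∑ q, Y.submatrix (fun _ : Fin 1 => c q) (fun _ : Fin 1 => c q)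
      = Matrix.of fun _ _ => Y.trace - (Y.submatrix e e).trace := by
    ext i j
    simp [Matrix.sum_apply, htr]
  rw [Fintype.sum_option, basisIsometry_sumElim_mul_fromBlocks_mul]
  congr 1
  · rw [← basisIsometry_conjTranspose_mul_mul]
    simp only [collapseKraus, Matrix.conjTranspose_mul, Matrix.conjTranspose_conjTranspose,
      Matrix.mul_assoc]
  · rw [← hsum, Matrix.mul_sum, Matrix.sum_mul]
    exact Finset.sum_congr rfl fun q _ => h1 q

/-- the generalized erasure channel Γ_{Λ⊗Λ} is, up to an isometric embedding
of its output, a quantum channel composed with Γ_Λ^{⊗2}. -/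
theorem gec_tensor_power_degradation (d K : ℕ)
    (A : Fin K → Matrix (Fin d) (Fin d) ℂ)
    (hA : (1 - ∑ k, (A k)ᴴ * A k).PosSemidef) :
    ∃ (V : Matrix ((Fin d ⊕ Fin 1) × (Fin d ⊕ Fin 1)) ((Fin d × Fin d) ⊕ Fin 1) ℂ),
      Vᴴ * V = 1 ∧
      ∃ (M : ℕ)
        (Km : Fin M → Matrix ((Fin d ⊕ Fin 1) × (Fin d ⊕ Fin 1))
          ((Fin d ⊕ Fin 1) × (Fin d ⊕ Fin 1)) ℂ),
        ∑ m, (Km m)ᴴ * Km m = 1 ∧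
        ∀ X : Matrix (Fin d × Fin d) (Fin d × Fin d) ℂ,
          ∑ m, Km m *
              (∑ s, ∑ t, (krausGEC A hA s ⊗ₖ krausGEC A hA t) * X *
                (krausGEC A hA s ⊗ₖ krausGEC A hA t)ᴴ) * (Km m)ᴴ
            = V * gec (fun Y => ∑ i, ∑ j, (A i ⊗ₖ A j) * Y * (A i ⊗ₖ A j)ᴴ) X * Vᴴ := by
  let e : Fin d × Fin d → (Fin d ⊕ Fin 1) × (Fin d ⊕ Fin 1) := Prod.map Sum.inl Sum.inl
  let c : (Fin d × Fin 1) ⊕ (Fin 1 × (Fin d ⊕ Fin 1)) → (Fin d ⊕ Fin 1) × (Fin d ⊕ Fin 1) :=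
    Sum.elim (Prod.map Sum.inl Sum.inr) (Prod.map Sum.inr id)
  let z : (Fin d ⊕ Fin 1) × (Fin d ⊕ Fin 1) := (Sum.inr 0, Sum.inr 0)
  have hbij : Function.Bijective (Sum.elim e c) := by
    constructor
    · rintro (⟨a, b⟩ | ⟨a, b⟩ | ⟨a, b⟩) (⟨a', b'⟩ | ⟨a', b'⟩ | ⟨a', b'⟩) h <;>
        simp_all [e, c]
    · rintro ⟨a | a, b | b⟩
      · exact ⟨Sum.inl (a, b), rfl⟩
      · exact ⟨Sum.inr (Sum.inl (a, b)), rfl⟩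
      · exact ⟨Sum.inr (Sum.inr (a, Sum.inl b)), rfl⟩
      · exact ⟨Sum.inr (Sum.inr (a, Sum.inr b)), rfl⟩
  have hV : Function.Injective (Sum.elim e fun _ : Fin 1 => z) := by
    rintro (⟨a, b⟩ | a) (⟨a', b'⟩ | a') h
    · simpa [e] using h
    · simp [e, z] at h
    · simp [e, z] at h
    · rw [Subsingleton.elim a a']
  let σ := (Fintype.equivFin (Option ((Fin d × Fin 1) ⊕ (Fin 1 × (Fin d ⊕ Fin 1))))).symm
  refine ⟨basisIsometry (Sum.elim e fun _ : Fin 1 => z),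
    basisIsometry_conjTranspose_mul_self hV, _, fun i => collapseKraus e c z (σ i), ?_, ?_⟩
  · rw [σ.sum_comp fun o => (collapseKraus e c z o)ᴴ * collapseKraus e c z o]
    exact sum_collapseKraus_conjTranspose_mul e c z hbij
  · intro X
    set Y := ∑ s, ∑ t, (krausGEC A hA s ⊗ₖ krausGEC A hA t) * X *
      (krausGEC A hA s ⊗ₖ krausGEC A hA t)ᴴ with hY
    have hblock : Y.submatrix e e = ∑ i, ∑ j, (A i ⊗ₖ A j) * X * (A i ⊗ₖ A j)ᴴ :=
      submatrix_sum_krausGEC_kronecker A hA X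
    have htr : Y.trace = X.trace := by
      rw [hY, ← Fintype.sum_prod_type' fun s t => (krausGEC A hA s ⊗ₖ krausGEC A hA t) * X *
        (krausGEC A hA s ⊗ₖ krausGEC A hA t)ᴴ]
      exact trace_sum_mul_mul_conjTranspose _
        (sum_kronecker_conjTranspose_mul _ (sum_krausGEC_conjTranspose_mul A hA)) X
    rw [σ.sum_comp fun o => collapseKraus e c z o * Y * (collapseKraus e c z o)ᴴ,
      sum_collapseKraus_mul_mul e c z hbij Y, hblock, htr, gec]
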